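/- For every finite set V ⊆ [0,1] with {0,1} ⊆ V and every BQCTL*[F] path formula ψ over AP, the set V(ψ) = {⟦ψ⟧_t(λ) : t an (AP,V)-labelled D-tree, λ a branch of t} of satisfaction values taken by ψ on branches of (AP,V)-labelled D-trees has cardinality at most |V|^{|ψ|}. -/

import Mathlib

open scoped Classical

mutual
inductive StateF (AP : Type) : Type where
  | atom : AP → StateF AP
  | app : (n : ℕ) → ((Fin n → ℝ) → ℝ) → (Fin n → StateF AP) → StateF AP
  | ex : AP → StateF AP → StateF AP
  | E : PathF AP → StateF AP

inductive PathF (AP : Type) : Type where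
  | state : StateF AP → PathF AP
  | next : PathF AP → PathF AP
  | until_ : PathF AP → PathF AP → PathF AP
  | app : (n : ℕ) → ((Fin n → ℝ) → ℝ) → (Fin n → PathF AP) → PathF AP
end

variable {AP D : Type}

mutual
def ssize : StateF AP → ℕ
  | .atom _ => 1
  | .app n _ args => 1 + Finset.univ.sum (fun i : Fin n => ssize (args i))
  | .ex _ φ => 1 + ssize φ
  | .E ψ => 1 + psize ψ
def psize : PathF AP → ℕ
  | .state φ => ssize φ
  | .next ψ => 1 + psize ψ
  | .until_ ψ₁ ψ₂ => 1 + psize ψ₁ + psize ψ₂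
  | .app n _ args => 1 + Finset.univ.sum (fun i : Fin n => psize (args i))
end

structure LTree (D L : Type) where
  dom : Set (List D)
  label : List D → L

def IsTree (t : LTree D L) : Prop :=
  ([] ∈ t.dom) ∧ (∀ u ∈ t.dom, ∀ v : List D, v <+: u → v ∈ t.dom) ∧
    (∀ u ∈ t.dom, ∃ d : D, u ++ [d] ∈ t.dom)

def Labelled (t : LTree D (AP → ℝ)) (V : Set ℝ) : Prop :=
  ∀ u ∈ t.dom, ∀ p, t.label u p ∈ V

def IsBranch (t : LTree D L) (u : List D) (lam : ℕ → List D) : Prop :=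
  lam 0 = u ∧ ∀ i, lam i ∈ t.dom ∧ ∃ d : D, lam (i + 1) = lam i ++ [d]

def PropEquiv (p : AP) (t t' : LTree D (AP → ℝ)) : Prop :=
  t'.dom = t.dom ∧
    ∀ u ∈ t.dom, (∀ q, q ≠ p → t'.label u q = t.label u q) ∧
      (t'.label u p = 0 ∨ t'.label u p = 1)

mutual
noncomputable def ssem : StateF AP → LTree D (AP → ℝ) → List D → ℝ
  | .atom p, t, u => t.label u p
  | .app n f args, t, u => f fun i => ssem (args i) t u
  | .ex p φ, t, u => sSup {v | ∃ t', PropEquiv p t t' ∧ ssem φ t' u = v}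
  | .E ψ, t, u => sSup {v | ∃ lam, IsBranch t u lam ∧ psem ψ t lam = v}
noncomputable def psem : PathF AP → LTree D (AP → ℝ) → (ℕ → List D) → ℝ
  | .state φ, t, lam => ssem φ t (lam 0)
  | .next ψ, t, lam => psem ψ t fun k => lam (1 + k)
  | .until_ ψ₁ ψ₂, t, lam =>
      sSup {v | ∃ i : ℕ,
        v = min (psem ψ₂ t fun k => lam (i + k))
          (sInf ({w | ∃ j < i, psem ψ₁ t (fun k => lam (j + k)) = w} ∪ {1}))}
  | .app n f args, t, lam => f fun i => psem (args i) t lam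
end

def ValS (D : Type) (V : Set ℝ) (φ : StateF AP) : Set ℝ :=
  {v | ∃ t : LTree D (AP → ℝ), ∃ u : List D,
    IsTree t ∧ Labelled t V ∧ u ∈ t.dom ∧ ssem φ t u = v}

def ValP (D : Type) (V : Set ℝ) (ψ : PathF AP) : Set ℝ :=
  {v | ∃ t : LTree D (AP → ℝ), ∃ u : List D, ∃ lam : ℕ → List D,
    IsTree t ∧ Labelled t V ∧ u ∈ t.dom ∧ IsBranch t u lam ∧ psem ψ t lam = v}

theorem IsBranch.suffix {L : Type} {t : LTree D L} {u : List D} {lam : ℕ → List D}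
    (h : IsBranch t u lam) (i : ℕ) : IsBranch t (lam i) fun k => lam (i + k) :=
  ⟨rfl, fun k => h.2 (i + k)⟩

theorem IsTree.exists_isBranch {L : Type} {t : LTree D L} (ht : IsTree t) {u : List D}
    (hu : u ∈ t.dom) : ∃ lam, IsBranch t u lam := by
  obtain ⟨d, -⟩ := ht.2.2 u hu
  have : Nonempty D := ⟨d⟩
  choose! next hnext using ht.2.2
  let lam : ℕ → List D := fun k => Nat.rec u (fun _ v => v ++ [next v]) k
  have hdom : ∀ i, lam i ∈ t.dom := by
    intro i
    induction i with
    | zero => exact hu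
    | succ i ih => exact hnext _ ih
  exact ⟨lam, rfl, fun i => ⟨hdom i, next (lam i), rfl⟩⟩

theorem PropEquiv.isTree {p : AP} {t t' : LTree D (AP → ℝ)} (h : PropEquiv p t t')
    (ht : IsTree t) : IsTree t' := by
  unfold IsTree at ht ⊢
  rwa [h.1]

theorem PropEquiv.labelled {V : Set ℝ} (h0 : (0 : ℝ) ∈ V) (h1 : (1 : ℝ) ∈ V) {p : AP}
    {t t' : LTree D (AP → ℝ)} (h : PropEquiv p t t') (ht : Labelled t V) : Labelled t' V := by
  intro u hu q
  have hu' : u ∈ t.dom := h.1 ▸ hu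
  by_cases hq : q = p
  · subst hq
    rcases (h.2 u hu').2 with e | e <;> rw [e] <;> assumption
  · rw [(h.2 u hu').1 q hq]
    exact ht u hu' q

theorem PropEquiv.exists_right (p : AP) (t : LTree D (AP → ℝ)) : ∃ t', PropEquiv p t t' :=
  ⟨⟨t.dom, fun u => Function.update (t.label u) p 0⟩, rfl, fun _ _ =>
    ⟨fun _ hq => Function.update_of_ne hq _ _, Or.inl (Function.update_self p 0 _)⟩⟩

theorem Set.Finite.csSup_mem_of_subset {s t : Set ℝ} (ht : t.Finite) (hst : s ⊆ t)
    (hs : s.Nonempty) : sSup s ∈ t :=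
  hst (hs.csSup_mem (ht.subset hst))

theorem mem_valP {V : Set ℝ} {ψ : PathF AP} {t : LTree D (AP → ℝ)} {u : List D}
    {lam : ℕ → List D} (ht : IsTree t) (hV : Labelled t V) (hlam : IsBranch t u lam) :
    psem ψ t lam ∈ ValP D V ψ :=
  ⟨t, u, lam, ht, hV, hlam.1 ▸ (hlam.2 0).1, hlam, rfl⟩

theorem valS_atom_subset (V : Set ℝ) (p : AP) : ValS D V (.atom p) ⊆ V := by
  rintro _ ⟨t, u, -, hV, hu, rfl⟩
  simpa only [ssem] using hV u hu p

theorem valS_app_subset (V : Set ℝ) (n : ℕ) (f : (Fin n → ℝ) → ℝ) (args : Fin n → StateF AP) :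
    ValS D V (.app n f args) ⊆ f '' Set.univ.pi fun i => ValS D V (args i) := by
  rintro _ ⟨t, u, ht, hV, hu, rfl⟩
  exact ⟨fun i => ssem (args i) t u, fun i _ => ⟨t, u, ht, hV, hu, rfl⟩, by simp only [ssem]⟩

theorem valS_ex_subset {V : Set ℝ} (h0 : (0 : ℝ) ∈ V) (h1 : (1 : ℝ) ∈ V) (p : AP)
    {φ : StateF AP} (hφ : (ValS D V φ).Finite) : ValS D V (.ex p φ) ⊆ ValS D V φ := by
  rintro _ ⟨t, u, ht, hV, hu, rfl⟩
  simp only [ssem]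
  refine hφ.csSup_mem_of_subset ?_ ?_
  · rintro _ ⟨t', ht', rfl⟩
    exact ⟨t', u, ht'.isTree ht, ht'.labelled h0 h1 hV, ht'.1 ▸ hu, rfl⟩
  · obtain ⟨t', ht'⟩ := PropEquiv.exists_right p t
    exact ⟨_, t', ht', rfl⟩

theorem valS_E_subset {V : Set ℝ} {ψ : PathF AP} (hψ : (ValP D V ψ).Finite) :
    ValS D V (.E ψ) ⊆ ValP D V ψ := by
  rintro _ ⟨t, u, ht, hV, hu, rfl⟩
  simp only [ssem]
  refine hψ.csSup_mem_of_subset ?_ ?_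
  · rintro _ ⟨lam, hlam, rfl⟩
    exact mem_valP ht hV hlam
  · obtain ⟨lam, hlam⟩ := ht.exists_isBranch hu
    exact ⟨_, lam, hlam, rfl⟩

theorem valP_state_subset (V : Set ℝ) (φ : StateF AP) :
    ValP D V (.state φ) ⊆ ValS D V φ := by
  rintro _ ⟨t, u, lam, ht, hV, -, hlam, rfl⟩
  exact ⟨t, lam 0, ht, hV, (hlam.2 0).1, by simp only [psem]⟩

theorem valP_next_subset (V : Set ℝ) (ψ : PathF AP) :
    ValP D V (.next ψ) ⊆ ValP D V ψ := by
  rintro _ ⟨t, u, lam, ht, hV, -, hlam, rfl⟩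
  simp only [psem]
  exact mem_valP ht hV (hlam.suffix 1)

theorem valP_app_subset (V : Set ℝ) (n : ℕ) (f : (Fin n → ℝ) → ℝ) (args : Fin n → PathF AP) :
    ValP D V (.app n f args) ⊆ f '' Set.univ.pi fun i => ValP D V (args i) := by
  rintro _ ⟨t, u, lam, ht, hV, -, hlam, rfl⟩
  exact ⟨fun i => psem (args i) t lam, fun i _ => mem_valP ht hV hlam, by simp only [psem]⟩

theorem valP_until_subset {V : Set ℝ} {ψ₁ ψ₂ : PathF AP} (hψ₁ : (ValP D V ψ₁).Finite)
    (hψ₂ : (ValP D V ψ₂).Finite) :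
    ValP D V (.until_ ψ₁ ψ₂) ⊆ ValP D V ψ₂ ∪ (ValP D V ψ₁ ∪ {1}) := by
  rintro _ ⟨t, u, lam, ht, hV, -, hlam, rfl⟩
  simp only [psem]
  have hfin := hψ₁.union (Set.finite_singleton 1)
  refine (hψ₂.union hfin).csSup_mem_of_subset ?_ ⟨_, 0, rfl⟩
  rintro _ ⟨i, rfl⟩
  rcases min_choice (psem ψ₂ t fun k => lam (i + k))
    (sInf ({w | ∃ j < i, psem ψ₁ t (fun k => lam (j + k)) = w} ∪ {1})) with e | e <;> rw [e]
  · exact Or.inl (mem_valP ht hV (hlam.suffix i))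
  · right
    have hsub : {w | ∃ j < i, psem ψ₁ t (fun k => lam (j + k)) = w} ∪ {1} ⊆
        ValP D V ψ₁ ∪ {1} := by
      refine Set.union_subset_union_left _ ?_
      rintro _ ⟨j, -, rfl⟩
      exact mem_valP ht hV (hlam.suffix j)
    exact hsub (Set.Nonempty.csInf_mem ⟨1, Or.inr rfl⟩ (hfin.subset hsub))

theorem finite_ncard_le_of_subset {s t : Set ℝ} (hst : s ⊆ t) {k m n : ℕ} (hk : 0 < k)
    (hmn : m ≤ n) (ht : t.Finite ∧ t.ncard ≤ k ^ m) : s.Finite ∧ s.ncard ≤ k ^ n :=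
  ⟨ht.1.subset hst,
    (Set.ncard_le_ncard hst ht.1).trans (ht.2.trans (Nat.pow_le_pow_right hk hmn))⟩

theorem finite_ncard_image_pi_le {n k : ℕ} (f : (Fin n → ℝ) → ℝ) {s : Fin n → Set ℝ}
    {m : Fin n → ℕ} (h : ∀ i, (s i).Finite ∧ (s i).ncard ≤ k ^ m i) :
    (f '' Set.univ.pi s).Finite ∧ (f '' Set.univ.pi s).ncard ≤ k ^ ∑ i, m i := by
  have hfin : (Set.univ.pi s).Finite := Set.Finite.pi fun i => (h i).1
  refine ⟨hfin.image f, (Set.ncard_image_le hfin).trans ?_⟩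
  calc (Set.univ.pi s).ncard = ∏ i, (s i).ncard := by
        simp only [← Nat.card_coe_set_eq, Nat.card_congr (Equiv.Set.univPi s), Nat.card_pi]
    _ ≤ ∏ i, k ^ m i := Finset.prod_le_prod' fun i _ => (h i).2
    _ = k ^ ∑ i, m i := Finset.prod_pow_eq_pow_sum _ _ _

mutual
theorem ssize_pos : ∀ φ : StateF AP, 0 < ssize φ
  | .atom _ => by simp only [ssize]; omega
  | .app _ _ _ => by simp only [ssize]; omega
  | .ex _ _ => by simp only [ssize]; omega
  | .E _ => by simp only [ssize]; omega
theorem psize_pos : ∀ ψ : PathF AP, 0 < psize ψ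
  | .state φ => by simpa only [psize] using ssize_pos φ
  | .next _ => by simp only [psize]; omega
  | .until_ _ _ => by simp only [psize]; omega
  | .app _ _ _ => by simp only [psize]; omega
end

theorem pow_add_pow_add_one_le {k a b : ℕ} (hk : 2 ≤ k) (ha : 0 < a) (hb : 0 < b) :
    k ^ b + (k ^ a + 1) ≤ k ^ (1 + a + b) := by
  have hka : 2 ≤ k ^ a := hk.trans (Nat.le_self_pow ha.ne' k)
  have hkb : 2 ≤ k ^ b := hk.trans (Nat.le_self_pow hb.ne' k)
  calc k ^ b + (k ^ a + 1) ≤ 2 * (k ^ a * k ^ b) := by nlinarith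
    _ ≤ k * (k ^ a * k ^ b) := Nat.mul_le_mul_right _ hk
    _ = k ^ (1 + a + b) := by ring

mutual
theorem finite_ncard_valS_le {V : Set ℝ} (hV : V.Finite) (h0 : (0 : ℝ) ∈ V) (h1 : (1 : ℝ) ∈ V)
    (hk : 2 ≤ V.ncard) : ∀ φ : StateF AP,
      (ValS D V φ).Finite ∧ (ValS D V φ).ncard ≤ V.ncard ^ ssize φ
  | .atom p => by
    rw [ssize]
    exact finite_ncard_le_of_subset (valS_atom_subset V p) (by omega) le_rfl ⟨hV, by simp⟩
  | .app n f args => by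
    rw [ssize]
    exact finite_ncard_le_of_subset (valS_app_subset V n f args) (by omega) (by omega)
      (finite_ncard_image_pi_le f fun i => finite_ncard_valS_le hV h0 h1 hk (args i))
  | .ex p φ => by
    have ih := finite_ncard_valS_le hV h0 h1 hk φ
    rw [ssize]
    exact finite_ncard_le_of_subset (valS_ex_subset h0 h1 p ih.1) (by omega) (by omega) ih
  | .E ψ => by
    have ih := finite_ncard_valP_le hV h0 h1 hk ψ
    rw [ssize]
    exact finite_ncard_le_of_subset (valS_E_subset ih.1) (by omega) (by omega) ih
theorem finite_ncard_valP_le {V : Set ℝ} (hV : V.Finite) (h0 : (0 : ℝ) ∈ V) (h1 : (1 : ℝ) ∈ V)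
    (hk : 2 ≤ V.ncard) : ∀ ψ : PathF AP,
      (ValP D V ψ).Finite ∧ (ValP D V ψ).ncard ≤ V.ncard ^ psize ψ
  | .state φ => by
    rw [psize]
    exact finite_ncard_le_of_subset (valP_state_subset V φ) (by omega) le_rfl
      (finite_ncard_valS_le hV h0 h1 hk φ)
  | .next ψ => by
    rw [psize]
    exact finite_ncard_le_of_subset (valP_next_subset V ψ) (by omega) (by omega)
      (finite_ncard_valP_le hV h0 h1 hk ψ)
  | .until_ ψ₁ ψ₂ => by
    have ih₁ := finite_ncard_valP_le hV h0 h1 hk ψ₁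
    have ih₂ := finite_ncard_valP_le hV h0 h1 hk ψ₂
    rw [psize]
    refine finite_ncard_le_of_subset (valP_until_subset ih₁.1 ih₂.1) (by omega) le_rfl
      ⟨ih₂.1.union (ih₁.1.union (Set.finite_singleton 1)), ?_⟩
    calc _ ≤ (ValP D V ψ₂).ncard + ((ValP D V ψ₁).ncard + 1) :=
          (Set.ncard_union_le _ _).trans
            (Nat.add_le_add_left ((Set.ncard_union_le _ _).trans (by simp)) _)
      _ ≤ V.ncard ^ psize ψ₂ + (V.ncard ^ psize ψ₁ + 1) := by gcongr; exacts [ih₂.2, ih₁.2]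
      _ ≤ _ := pow_add_pow_add_one_le hk (psize_pos ψ₁) (psize_pos ψ₂)
  | .app n f args => by
    rw [psize]
    exact finite_ncard_le_of_subset (valP_app_subset V n f args) (by omega) (by omega)
      (finite_ncard_image_pi_le f fun i => finite_ncard_valP_le hV h0 h1 hk (args i))
end

/-- For every finite set `V ⊆ [0,1]` with `{0,1} ⊆ V` and every
BQCTL*[F] path formula `ψ` over `AP`, the set of satisfaction values taken by `ψ`
on branches of `(AP,V)`-labelled `D`-trees is finite, of cardinality at most `|V| ^ |ψ|`. -/
theorem stmt1 {AP D : Type} [Fintype AP] [Fintype D] [Nonempty D]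
    (V : Set ℝ) (hVfin : V.Finite) (hVsub : V ⊆ Set.Icc (0 : ℝ) 1)
    (h0 : (0 : ℝ) ∈ V) (h1 : (1 : ℝ) ∈ V) (ψ : PathF AP) :
    (ValP D V ψ).Finite ∧ (ValP D V ψ).ncard ≤ V.ncard ^ psize ψ := by
  exact finite_ncard_valP_le hVfin h0 h1
    ((Set.one_lt_ncard hVfin).2 ⟨0, h0, 1, h1, zero_ne_one⟩) ψ
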